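/- For every integer n ≥ 0, C_n = d_n({312}) + d_{n+1}({312}), where C_n is the n-th Catalan number and d_n({312}) is the number of desarrangements of length n avoiding the pattern 312. -/

import Mathlib

open scoped Classical

/-- Index `i ∈ {1,…,n}` (1-indexed) is an ascent of the permutation `π` of length `n`,
written in one-line notation `π₁π₂⋯πₙ` with `πᵢ = π ⟨i-1, _⟩`: either `i = n`, or
`πᵢ < πᵢ₊₁`. -/
def IsAscent (n : ℕ) (π : Equiv.Perm (Fin n)) (i : ℕ) : Prop :=
  1 ≤ i ∧ i ≤ n ∧ (i = n ∨ ∃ h : i < n, π ⟨i - 1, by omega⟩ < π ⟨i, h⟩)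

/-- A permutation is a desarrangement if it is empty or its first (smallest) ascent is even. -/
def IsDesarrangement (n : ℕ) (π : Equiv.Perm (Fin n)) : Prop :=
  n = 0 ∨ ∃ i, IsAscent n π i ∧ Even i ∧ ∀ j, IsAscent n π j → i ≤ j

/-- `π` contains the pattern `σ` (where `σ` is given in 0-indexed one-line notation):
there are positions `i₁ < ⋯ < i_k` such that the letters of `π` at these positions are
in the same relative order as the letters of `σ`. -/
def ContainsPattern {k n : ℕ} (σ : Fin k → Fin k) (π : Equiv.Perm (Fin n)) : Prop :=
  ∃ f : Fin k ↪o Fin n, ∀ a b : Fin k, π (f a) < π (f b) ↔ σ a < σ b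

/-- `d_n(P)`: the number of desarrangements of length `n` avoiding every pattern in `P`
(patterns of length 3, in 0-indexed one-line notation). -/
noncomputable def dcount (n : ℕ) (P : Finset (Fin 3 → Fin 3)) : ℕ :=
  (Finset.univ.filter fun π : Equiv.Perm (Fin n) =>
    IsDesarrangement n π ∧ ∀ σ ∈ P, ¬ ContainsPattern σ π).card

/-- A list avoids the pattern `312`. -/
def Avoids312 : List ℕ → Prop
  | [] => True
  | c :: l => l.Pairwise (fun a b => ¬ (a < b ∧ b < c)) ∧ Avoids312 l

/-- The length of the initial strictly decreasing run of a list. -/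
def initialRun : List ℕ → ℕ
  | [] => 0
  | [_] => 1
  | x :: y :: l => if y < x then initialRun (y :: l) + 1 else 1

/-- The `312`-avoiding arrangements of the interval `{a, …, a + n - 1}`. -/
noncomputable def avoiders (a n : ℕ) : Finset (List ℕ) :=
  (List.range' a n).permutations.toFinset.filter Avoids312

theorem mem_avoiders {a n : ℕ} {l : List ℕ} :
    l ∈ avoiders a n ↔ (l.Nodup ∧ ∀ x, x ∈ l ↔ a ≤ x ∧ x < a + n) ∧ Avoids312 l := by
  have key : l.Perm (List.range' a n) ↔ l.Nodup ∧ ∀ x, x ∈ l ↔ a ≤ x ∧ x < a + n := by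
    constructor
    · intro h
      exact ⟨h.nodup_iff.2 List.nodup_range', fun x => by rw [h.mem_iff, List.mem_range'_1]⟩
    · rintro ⟨h, h'⟩
      rw [List.perm_ext_iff_of_nodup h List.nodup_range']
      intro x
      rw [h', List.mem_range'_1]
  simp only [avoiders, Finset.mem_filter, List.mem_toFinset, List.mem_permutations, key]

theorem length_of_mem_avoiders {a n : ℕ} {l : List ℕ} (h : l ∈ avoiders a n) :
    l.length = n := by
  simp only [avoiders, Finset.mem_filter, List.mem_toFinset, List.mem_permutations] at h
  simpa using h.1.length_eq

theorem avoids312_append_cons {a : ℕ} {L R : List ℕ} (hL : ∀ x ∈ L, a < x)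
    (hLR : ∀ x ∈ L, ∀ y ∈ R, x < y) (hR : ∀ y ∈ R, a < y) :
    Avoids312 (L ++ a :: R) ↔ Avoids312 L ∧ Avoids312 R := by
  induction L with
  | nil =>
    simp only [List.nil_append, Avoids312, true_and, and_iff_right_iff_imp]
    intro _
    refine List.pairwise_of_forall_mem_list ?_
    intro x _ y hy h
    have := hR y hy
    omega
  | cons c L ih =>
    have ih := ih (fun x hx => hL x (by simp [hx])) (fun x hx => hLR x (by simp [hx]))
    simp only [List.cons_append, Avoids312, ih, List.pairwise_append, List.pairwise_cons]
    have hc := hLR c (by simp)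
    have h1 : ∀ x ∈ R, ¬ (a < x ∧ x < c) := fun x hx h => by
      have := hc x hx
      omega
    have h2 : R.Pairwise (fun x y => ¬ (x < y ∧ y < c)) := by
      refine List.pairwise_of_forall_mem_list ?_
      intro x _ y hy h
      have := hc y hy
      omega
    have h3 : ∀ x ∈ L, ∀ y ∈ a :: R, ¬ (x < y ∧ y < c) := by
      intro x hx y hy h
      rcases List.mem_cons.1 hy with rfl | hy
      · have := hL x (by simp [hx])
        omega
      · have := hc y hy
        omega
    tauto

theorem Avoids312.le_of_append_cons {a : ℕ} {L R : List ℕ} (h : Avoids312 (L ++ a :: R))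
    (hR : ∀ y ∈ R, a < y) : ∀ x ∈ L, ∀ y ∈ R, x ≤ y := by
  induction L with
  | nil => simp
  | cons c L ih =>
    intro x hx y hy
    rcases List.mem_cons.1 hx with rfl | hx
    · have h1 := (List.pairwise_append.1 h.1).2.1
      have h2 := (List.pairwise_cons.1 h1).1 y hy
      have := hR y hy
      omega
    · exact ih h.2 x hx y hy

theorem eq_Ico_of_initial {T : Finset ℕ} {b : ℕ} (hb : ∀ x ∈ T, b ≤ x)
    (h : ∀ y ∈ T, ∀ x, b ≤ x → x ≤ y → x ∈ T) : T = Finset.Ico b (b + T.card) := by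
  rcases T.eq_empty_or_nonempty with rfl | hT
  · simp
  · have hM := T.max'_mem hT
    have e : T = Finset.Ico b (T.max' hT + 1) := by
      ext x
      rw [Finset.mem_Ico]
      refine ⟨fun hx => ⟨hb x hx, Nat.lt_succ_of_le (T.le_max' x hx)⟩, fun hx => ?_⟩
      exact h _ hM x hx.1 (by omega)
    have hc : T.card = T.max' hT + 1 - b := by
      conv_lhs => rw [e]
      simp
    have := hb _ hM
    rw [hc, show b + (T.max' hT + 1 - b) = T.max' hT + 1 by omega]
    exact e

theorem append_cons_mem_avoiders {a i j : ℕ} {L R : List ℕ} (hL : L ∈ avoiders (a + 1) i)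
    (hR : R ∈ avoiders (a + 1 + i) j) : L ++ a :: R ∈ avoiders a (i + j + 1) := by
  rw [mem_avoiders] at *
  obtain ⟨⟨hLn, hLm⟩, hLa⟩ := hL
  obtain ⟨⟨hRn, hRm⟩, hRa⟩ := hR
  refine ⟨⟨?_, ?_⟩, ?_⟩
  · rw [List.nodup_append]
    refine ⟨hLn, List.nodup_cons.2 ⟨?_, hRn⟩, ?_⟩
    · rw [hRm]; omega
    · intro x hx y hy
      rw [List.mem_cons, hRm] at hy
      rw [hLm] at hx
      omega
  · intro x
    rw [List.mem_append, List.mem_cons, hRm, hLm]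
    omega
  · rw [avoids312_append_cons]
    · exact ⟨hLa, hRa⟩
    · intro x hx; rw [hLm] at hx; omega
    · intro x hx y hy; rw [hLm] at hx; rw [hRm] at hy; omega
    · intro x hx; rw [hRm] at hx; omega

theorem exists_of_mem_avoiders_succ {a n : ℕ} {l : List ℕ} (h : l ∈ avoiders a (n + 1)) :
    ∃ L R, l = L ++ a :: R ∧ ∃ i ≤ n,
      L ∈ avoiders (a + 1) i ∧ R ∈ avoiders (a + 1 + i) (n - i) := by
  have hlen := length_of_mem_avoiders h
  rw [mem_avoiders] at h
  obtain ⟨⟨hn, hm⟩, ha⟩ := h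
  obtain ⟨L, R, rfl⟩ := List.append_of_mem ((hm a).2 (by omega))
  rw [List.nodup_append, List.nodup_cons] at hn
  obtain ⟨hLn, ⟨haR, hRn⟩, hdis⟩ := hn
  have hL : ∀ x ∈ L, a < x := fun x hx => by
    have h1 := (hm x).1 (by simp [hx])
    have h2 := hdis x hx a (by simp)
    omega
  have hR : ∀ x ∈ R, a < x := fun x hx => by
    have h1 := (hm x).1 (by simp [hx])
    have h2 : x ≠ a := fun e => haR (e ▸ hx)
    omega
  have hLR : ∀ x ∈ L, ∀ y ∈ R, x < y := fun x hx y hy => by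
    have h1 := ha.le_of_append_cons hR x hx y hy
    have h2 := hdis x hx y (by simp [hy])
    omega
  rw [avoids312_append_cons hL hLR hR] at ha
  have hm' : ∀ x, x ∈ L ∨ x ∈ R ↔ a + 1 ≤ x ∧ x < a + 1 + n := by
    intro x
    have := hm x
    rw [List.mem_append, List.mem_cons] at this
    constructor
    · intro hx
      have h1 := this.1 (by tauto)
      have h2 : a < x := hx.elim (hL x) (hR x)
      omega
    · intro hx
      have h1 := this.2 (by omega)
      have h2 : x ≠ a := by omega
      tauto
  have hT : L.toFinset = Finset.Ico (a + 1) (a + 1 + L.length) := by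
    rw [← List.toFinset_card_of_nodup hLn]
    refine eq_Ico_of_initial (fun x hx => hL x (by simpa using hx)) ?_
    intro y hy x hx hxy
    rw [List.mem_toFinset] at *
    have := (hm' y).1 (Or.inl hy)
    rcases (hm' x).2 (by omega) with h | h
    · exact h
    · have := hLR y hy x h
      omega
  have hLm : ∀ x, x ∈ L ↔ a + 1 ≤ x ∧ x < a + 1 + L.length := by
    intro x
    rw [← List.mem_toFinset, hT, Finset.mem_Ico]
  simp only [List.length_append, List.length_cons] at hlen
  refine ⟨L, R, rfl, L.length, by omega, ?_, ?_⟩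
  · rw [mem_avoiders]
    exact ⟨⟨hLn, hLm⟩, ha.1⟩
  · rw [mem_avoiders]
    refine ⟨⟨hRn, fun x => ?_⟩, ha.2⟩
    have h1 := hm' x
    have h2 := hLm x
    constructor
    · intro hx
      have h3 : x ∉ L := fun hx' => lt_irrefl _ (hLR x hx' x hx)
      have := h1.1 (Or.inr hx)
      rw [h2] at h3
      omega
    · intro hx
      have h3 : x ∉ L := by rw [h2]; omega
      have := h1.2 (by omega)
      tauto

theorem append_cons_inj {a : ℕ} {L R L' R' : List ℕ} (hL : a ∉ L) (hL' : a ∉ L')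
    (h : L ++ a :: R = L' ++ a :: R') : L = L' ∧ R = R' := by
  induction L generalizing L' with
  | nil =>
    cases L' with
    | nil => simpa using h
    | cons y L' => exact absurd (by simp_all) hL'
  | cons x L ih =>
    cases L' with
    | nil => exact absurd (by simp_all) hL
    | cons y L' =>
      simp only [List.cons_append, List.cons.injEq, List.mem_cons, not_or] at *
      have := ih hL.2 hL'.2 h.2
      exact ⟨⟨h.1, this.1⟩, this.2⟩

theorem card_avoiders (a n : ℕ) : (avoiders a n).card = catalan n := by
  induction n using Nat.strong_induction_on generalizing a with
  | _ n ih =>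
  cases n with
  | zero =>
    rw [catalan_zero, Finset.card_eq_one]
    refine ⟨[], ?_⟩
    ext l
    rw [Finset.mem_singleton]
    constructor
    · intro h
      exact List.length_eq_zero_iff.1 (length_of_mem_avoiders h)
    · rintro rfl
      simp [mem_avoiders, Avoids312]
  | succ n =>
    rw [catalan_succ]
    have hcard : ∀ i : Fin (n + 1), catalan i * catalan (n - i) =
        (avoiders (a + 1) i ×ˢ avoiders (a + 1 + i) (n - i)).card := by
      intro i
      rw [Finset.card_product, ih i (by omega), ih (n - i) (by omega)]
    rw [Finset.sum_congr rfl fun i _ => hcard i, ← Finset.card_sigma]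
    symm
    refine Finset.card_bij (fun p _ => p.2.1 ++ a :: p.2.2) ?_ ?_ ?_
    · rintro ⟨i, L, R⟩ h
      simp only [Finset.mem_sigma, Finset.mem_product, Finset.mem_univ, true_and] at h
      have := append_cons_mem_avoiders h.1 h.2
      rwa [show (i : ℕ) + (n - i) + 1 = n + 1 by omega] at this
    · rintro ⟨i, L, R⟩ h ⟨i', L', R'⟩ h' e
      simp only [Finset.mem_sigma, Finset.mem_product, Finset.mem_univ, true_and] at h h' e
      have hL := length_of_mem_avoiders h.1
      have hL' := length_of_mem_avoiders h'.1
      rw [mem_avoiders] at h h'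
      obtain ⟨rfl, rfl⟩ := append_cons_inj (by rw [h.1.1.2]; omega) (by rw [h'.1.1.2]; omega) e
      obtain rfl : i = i' := Fin.ext (by omega)
      rfl
    · intro l hl
      obtain ⟨L, R, rfl, i, hi, hL, hR⟩ := exists_of_mem_avoiders_succ hl
      exact ⟨⟨⟨i, by omega⟩, L, R⟩, by simp [hL, hR], rfl⟩

/-- The increasing map of `ℕ` omitting only the value `x + 1`. -/
def skipSucc (x y : ℕ) : ℕ := if y ≤ x then y else y + 1

theorem skipSucc_strictMono (x : ℕ) : StrictMono (skipSucc x) := by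
  intro a b h
  unfold skipSucc
  split_ifs <;> omega

/-- Insert, in front of a list with head `x`, the value `x + 1`, shifting larger values up. -/
def prependSucc : List ℕ → List ℕ
  | [] => []
  | x :: l => (x + 1) :: (x :: l).map (skipSucc x)

theorem avoids312_map {f : ℕ → ℕ} (hf : StrictMono f) (l : List ℕ) :
    Avoids312 (l.map f) ↔ Avoids312 l := by
  induction l with
  | nil => rfl
  | cons c l ih => simp only [List.map_cons, Avoids312, ih, List.pairwise_map, hf.lt_iff_lt]

theorem initialRun_map {f : ℕ → ℕ} (hf : StrictMono f) (l : List ℕ) :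
    initialRun (l.map f) = initialRun l := by
  induction l with
  | nil => rfl
  | cons c l ih =>
    cases l with
    | nil => rfl
    | cons d l =>
      simp only [List.map_cons, initialRun, hf.lt_iff_lt] at *
      rw [ih]

theorem initialRun_prependSucc (x : ℕ) (l : List ℕ) :
    initialRun (prependSucc (x :: l)) = initialRun (x :: l) + 1 := by
  rw [← initialRun_map (skipSucc_strictMono x) (x :: l)]
  simp [prependSucc, initialRun, skipSucc]

theorem prependSucc_mem_avoiders_iff {x n : ℕ} {l : List ℕ} :
    prependSucc (x :: l) ∈ avoiders 0 (n + 1) ↔ x :: l ∈ avoiders 0 n := by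
  have hmono := skipSucc_strictMono x
  have hne : ∀ z, skipSucc x z ≠ x + 1 := by
    intro z
    unfold skipSucc
    split_ifs <;> omega
  have hav (hn : (x :: l).Nodup) : Avoids312 (prependSucc (x :: l)) ↔ Avoids312 (x :: l) := by
    rw [← avoids312_map hmono (x :: l)]
    simp only [prependSucc]
    rw [Avoids312, and_iff_right_iff_imp]
    intro h
    have hx : skipSucc x x = x := by simp [skipSucc]
    rw [List.map_cons, hx] at h ⊢
    rw [List.pairwise_cons]
    constructor
    · intro y _
      omega
    · refine h.1.imp_of_mem ?_
      intro a b _ hb hab hab'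
      have hbx : b ≠ x := by
        rintro rfl
        obtain ⟨z, hz, hzb⟩ := List.mem_map.1 hb
        obtain rfl := (skipSucc_strictMono _).injective (hzb.trans hx.symm)
        exact (List.nodup_cons.1 hn).1 hz
      omega
  have hnd : (prependSucc (x :: l)).Nodup ↔ (x :: l).Nodup := by
    simp only [prependSucc]
    rw [List.nodup_cons, List.nodup_map_iff hmono.injective, and_iff_right_iff_imp]
    intro _ h
    obtain ⟨z, _, hz⟩ := List.mem_map.1 h
    exact hne z hz
  have hmem : (∀ z, z ∈ prependSucc (x :: l) ↔ 0 ≤ z ∧ z < 0 + (n + 1)) ↔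
      ∀ z, z ∈ x :: l ↔ 0 ≤ z ∧ z < 0 + n := by
    have hz : ∀ z, skipSucc x z ∈ prependSucc (x :: l) ↔ z ∈ x :: l := by
      intro z
      simp only [prependSucc]
      rw [List.mem_cons, or_iff_right (hne z), List.mem_map_of_injective hmono.injective]
    have hx1 : x + 1 ∈ prependSucc (x :: l) := by simp [prependSucc]
    constructor
    · intro h z
      have h1 := (h (x + 1)).1 hx1
      rw [← hz, h]
      unfold skipSucc
      split_ifs <;> omega
    · intro h z
      have hxn := (h x).1 (by simp)
      rcases lt_trichotomy z (x + 1) with hlt | rfl | hlt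
      · have e : skipSucc x z = z := by simp [skipSucc]; omega
        rw [← e, hz, h, e]
        omega
      · simp only [hx1, true_iff]
        omega
      · have e : skipSucc x (z - 1) = z := by
          unfold skipSucc
          split_ifs <;> omega
        rw [← e, hz, h, e]
        omega
  rw [mem_avoiders, mem_avoiders, hnd, hmem]
  exact and_congr_right fun h => hav h.1

theorem prependSucc_injective_cons {x y : ℕ} {l m : List ℕ}
    (h : prependSucc (x :: l) = prependSucc (y :: m)) : x :: l = y :: m := by
  simp only [prependSucc, List.cons.injEq, Nat.add_right_cancel_iff] at h
  obtain ⟨rfl, h⟩ := h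
  exact (List.map_injective_iff.2 (skipSucc_strictMono x).injective) h

theorem exists_prependSucc_of_lt {x y n : ℕ} {l : List ℕ} (h : x :: y :: l ∈ avoiders 0 n)
    (hyx : y < x) : ∃ m, prependSucc (y :: m) = x :: y :: l := by
  rw [mem_avoiders] at h
  obtain ⟨⟨hn, hm⟩, ha⟩ := h
  have hx := (hm x).1 (by simp)
  have e : x = y + 1 := by
    by_contra hne
    have h1 := (hm (y + 1)).2 (by omega)
    simp only [List.mem_cons] at h1
    have h2 : y + 1 ∈ l := by
      rcases h1 with h1 | h1 | h1
      · omega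
      · omega
      · exact h1
    have := (List.pairwise_cons.1 ha.1).1 _ h2
    omega
  subst e
  refine ⟨l.map fun z => if z ≤ y then z else z - 1, ?_⟩
  simp only [prependSucc, List.map_cons, List.map_map]
  congr 2
  · simp [skipSucc]
  · conv_rhs => rw [← List.map_id l]
    refine List.map_congr_left fun z hz => ?_
    have : z ≠ y + 1 := by
      rintro rfl
      simp [hz] at hn
    simp only [Function.comp, skipSucc, id]
    split_ifs <;> omega

theorem card_avoiders_odd (n : ℕ) :
    ((avoiders 0 n).filter fun l => ¬ Even (initialRun l)).card =
      ((avoiders 0 (n + 1)).filter fun l => Even (initialRun l)).card := by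
  refine Finset.card_bij (fun l _ => prependSucc l) ?_ ?_ ?_
  · intro l hl
    rw [Finset.mem_filter] at *
    cases l with
    | nil => simp [initialRun] at hl
    | cons x l =>
      rw [prependSucc_mem_avoiders_iff, initialRun_prependSucc, Nat.even_add_one]
      exact hl
  · intro l hl m hm e
    rw [Finset.mem_filter] at *
    cases l with
    | nil => simp [initialRun] at hl
    | cons x l =>
      cases m with
      | nil => simp [initialRun] at hm
      | cons y m => exact prependSucc_injective_cons e
  · intro l hl
    rw [Finset.mem_filter] at hl
    match l, hl with
    | [], hl => simpa using length_of_mem_avoiders hl.1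
    | [x], hl => simp [initialRun] at hl
    | x :: y :: l, hl =>
      by_cases hyx : y < x
      · obtain ⟨m, hm⟩ := exists_prependSucc_of_lt hl.1 hyx
        rw [← hm, prependSucc_mem_avoiders_iff, initialRun_prependSucc, Nat.even_add_one] at hl
        exact ⟨y :: m, Finset.mem_filter.2 hl, hm⟩
      · simp [initialRun, hyx] at hl

theorem avoids312_iff_getElem (l : List ℕ) : Avoids312 l ↔
    ∀ (i j k : ℕ) (hij : i < j) (hjk : j < k) (hk : k < l.length),
      ¬ (l[j] < l[k] ∧ l[k] < l[i]) := by
  induction l with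
  | nil => simp [Avoids312]
  | cons c l ih =>
    rw [Avoids312, ih, List.pairwise_iff_getElem]
    constructor
    · rintro ⟨h1, h2⟩ i j k hij hjk hk
      obtain ⟨j, rfl⟩ : ∃ j', j = j' + 1 := ⟨j - 1, by omega⟩
      obtain ⟨k, rfl⟩ : ∃ k', k = k' + 1 := ⟨k - 1, by omega⟩
      simp only [List.length_cons, Nat.add_lt_add_iff_right] at hk hjk
      cases i with
      | zero => simpa using h1 j k (by omega) hk hjk
      | succ i => simpa using h2 i j k (by omega) hjk hk
    · intro h
      constructor
      · intro j k hj hk hjk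
        exact h 0 (j + 1) (k + 1) (by omega) (by omega) (by simpa using hk)
      · intro i j k hij hjk hk
        exact h (i + 1) (j + 1) (k + 1) (by omega) (by omega) (by simpa using hk)

theorem initialRun_spec (l : List ℕ) (hl : l ≠ []) :
    1 ≤ initialRun l ∧ initialRun l ≤ l.length ∧
    (∀ (j : ℕ) (hj : j < l.length), 1 ≤ j → j < initialRun l → l[j] < l[j - 1]) ∧
    (initialRun l = l.length ∨
      ∃ h : initialRun l < l.length, l[initialRun l - 1] ≤ l[initialRun l]) := by
  induction l with
  | nil => exact absurd rfl hl
  | cons x l ih =>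
    cases l with
    | nil =>
      refine ⟨le_rfl, le_rfl, ?_, Or.inl rfl⟩
      intro j hj h1 h2
      simp at hj
      omega
    | cons y l =>
      obtain ⟨h1, h2, h3, h4⟩ := ih (by simp)
      by_cases hyx : y < x
      · have e : initialRun (x :: y :: l) = initialRun (y :: l) + 1 := by
          simp [initialRun, hyx]
        simp only [e]
        have hlen : (x :: y :: l).length = (y :: l).length + 1 := rfl
        refine ⟨by omega, by omega, ?_, ?_⟩
        · intro j hj hj1 hjr
          obtain ⟨j, rfl⟩ : ∃ j', j = j' + 1 := ⟨j - 1, by omega⟩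
          cases j with
          | zero => simpa using hyx
          | succ j => exact h3 (j + 1) (by omega) (by omega) (by omega)
        · rcases h4 with h4 | ⟨h, h4⟩
          · exact Or.inl (by omega)
          · refine Or.inr ⟨by omega, ?_⟩
            obtain ⟨r, hr⟩ : ∃ r, initialRun (y :: l) = r + 1 :=
              ⟨initialRun (y :: l) - 1, by omega⟩
            simp only [hr] at h4 ⊢
            simpa using h4
      · have e : initialRun (x :: y :: l) = 1 := by simp [initialRun, hyx]
        simp only [e]
        refine ⟨le_rfl, by simp, ?_, Or.inr ⟨by simp, by simpa using hyx⟩⟩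
        intro j _ hj1 hjr
        omega

/-- The one-line notation of a permutation, as a list of natural numbers. -/
def oneLine {n : ℕ} (π : Equiv.Perm (Fin n)) : List ℕ := List.ofFn fun i => (π i : ℕ)

theorem isDesarrangement_iff {n : ℕ} (π : Equiv.Perm (Fin n)) :
    IsDesarrangement n π ↔ Even (initialRun (oneLine π)) := by
  rcases Nat.eq_zero_or_pos n with rfl | hn
  · simp [IsDesarrangement, oneLine, initialRun]
  have hlen : (oneLine π).length = n := by simp [oneLine]
  obtain ⟨h1, h2, h3, h4⟩ := initialRun_spec (oneLine π) (by
    intro h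
    rw [h] at hlen
    simp at hlen
    omega)
  set r := initialRun (oneLine π)
  rw [hlen] at h2
  have hasc : IsAscent n π r := by
    refine ⟨h1, h2, ?_⟩
    rcases h4 with h4 | ⟨h, h4⟩
    · exact Or.inl (h4.trans hlen)
    · rw [hlen] at h
      refine Or.inr ⟨h, lt_of_le_of_ne ?_ ?_⟩
      · simp only [oneLine, List.getElem_ofFn, Fin.val_fin_le] at h4
        exact h4
      · intro e
        have := congrArg Fin.val (π.injective e)
        simp only at this
        omega
  have hmin : ∀ j, IsAscent n π j → r ≤ j := by
    rintro j ⟨hj1, hjn, hj⟩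
    by_contra! hlt
    rcases hj with rfl | ⟨h, hj⟩
    · omega
    · have := h3 j (by omega) hj1 hlt
      simp only [oneLine, List.getElem_ofFn, Fin.val_fin_lt] at this
      exact lt_asymm this hj
  constructor
  · rintro (h | ⟨i, hi, hev, hi'⟩)
    · omega
    · rwa [← le_antisymm (hi' r hasc) (hmin i hi)]
  · intro h
    exact Or.inr ⟨r, hasc, h, hmin⟩

theorem not_containsPattern_iff {n : ℕ} (π : Equiv.Perm (Fin n)) :
    ¬ ContainsPattern ![2, 0, 1] π ↔ Avoids312 (oneLine π) := by
  rw [avoids312_iff_getElem, not_iff_comm]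
  push Not
  constructor
  · rintro ⟨i, j, k, hij, hjk, hk, h1, h2⟩
    simp only [oneLine, List.length_ofFn] at hk
    simp only [oneLine, List.getElem_ofFn, Fin.val_fin_lt] at h1 h2
    have hf : StrictMono (![⟨i, by omega⟩, ⟨j, by omega⟩, ⟨k, hk⟩] : Fin 3 → Fin n) := by
      rw [Fin.strictMono_iff_lt_succ]
      intro a
      fin_cases a
      · simpa using hij
      · simpa using hjk
    refine ⟨OrderEmbedding.ofStrictMono _ hf, ?_⟩
    have h3 := h1.trans h2
    intro a b
    fin_cases a <;> fin_cases b <;> simp [h1, h2, h3, h1.le, h2.le, h3.le]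
  · rintro ⟨f, hf⟩
    have h01 : f 0 < f 1 := f.lt_iff_lt.2 (by decide)
    have h12 : f 1 < f 2 := f.lt_iff_lt.2 (by decide)
    refine ⟨f 0, f 1, f 2, h01, h12, by simp [oneLine], ?_, ?_⟩
    · simpa [oneLine] using (hf 1 2).2 (by decide)
    · simpa [oneLine] using (hf 2 0).2 (by decide)

theorem dcount_eq_card_avoiders (n : ℕ) : dcount n {![2, 0, 1]} =
    ((avoiders 0 n).filter fun l => Even (initialRun l)).card := by
  refine Finset.card_bij (fun π _ => oneLine π) ?_ ?_ ?_
  · intro π hπ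
    simp only [Finset.mem_filter, Finset.mem_univ, true_and, Finset.mem_singleton,
      forall_eq, isDesarrangement_iff, not_containsPattern_iff] at hπ
    rw [Finset.mem_filter, mem_avoiders]
    refine ⟨⟨⟨?_, fun x => ?_⟩, hπ.2⟩, hπ.1⟩
    · exact List.nodup_ofFn.2 (Fin.val_injective.comp π.injective)
    · simp only [oneLine, List.mem_ofFn]
      constructor
      · rintro ⟨i, rfl⟩
        have := (π i).isLt
        omega
      · intro hx
        exact ⟨π.symm ⟨x, by omega⟩, by simp⟩
  · intro π _ ρ _ h
    ext i
    exact congrFun (List.ofFn_injective h) i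
  · intro l hl
    rw [Finset.mem_filter] at hl
    obtain ⟨hl, hev⟩ := hl
    have hlen := length_of_mem_avoiders hl
    rw [mem_avoiders] at hl
    obtain ⟨⟨hn, hm⟩, ha⟩ := hl
    let f : Fin n → Fin n := fun i =>
      ⟨l[(i : ℕ)]'(by omega), by
        have := (hm _).1 (List.getElem_mem (l := l) (n := i) (by omega))
        omega⟩
    have hf : Function.Injective f := by
      intro i j h
      exact Fin.ext ((hn.getElem_inj_iff).1 (congrArg Fin.val h))
    let π : Equiv.Perm (Fin n) := Equiv.ofBijective f (Finite.injective_iff_bijective.1 hf)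
    have hπ : oneLine π = l := by
      refine List.ext_getElem (by simp [oneLine, hlen]) fun i _ _ => ?_
      simp [oneLine, π, f]
    refine ⟨π, ?_, hπ⟩
    simp only [Finset.mem_filter, Finset.mem_univ, true_and, Finset.mem_singleton,
      forall_eq, isDesarrangement_iff, not_containsPattern_iff, hπ]
    exact ⟨hev, ha⟩

/-- For every integer `n ≥ 0`, `C_n = d_n({312}) + d_(n+1)({312})`. -/
theorem catalan_eq_dcount_312_add (n : ℕ) :
    catalan n = dcount n {![2,0,1]} + dcount (n + 1) {![2,0,1]} := by
  rw [dcount_eq_card_avoiders, dcount_eq_card_avoiders, ← card_avoiders_odd,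
    Finset.card_filter_add_card_filter_not, card_avoiders]
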